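/- Let p be prime, n ≥ 1, m ≥ 1, let α ∈ ℝ, λ > 0, 1 < r, q < ∞, and set q₁ = ⋯ = q_m = mq, r₁ = ⋯ = r_m = mr, α₁ = ⋯ = α_m = α/m, λ₁ = ⋯ = λ_m = λ/m. Let ψ be a nonnegative measurable function on (ℤ_p^*)^m. If H^{p,m}_ψ is bounded from MK̇^{α₁,λ₁}_{r₁,q₁}(ℚ_p^n) × ⋯ × MK̇^{α_m,λ_m}_{r_m,q_m}(ℚ_p^n) to MK̇^{α,λ}_{r,q}(ℚ_p^n), then C = ∫_{(ℤ_p^*)^m} |t₁|_p^{-(α₁+n/q₁−λ₁)} ⋯ |t_m|_p^{-(α_m+n/q_m−λ_m)} ψ(t₁,…,t_m) dt₁⋯dt_m < ∞, and moreover the operator norm of H^{p,m}_ψ between these spaces equals C. -/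

import Mathlib

open MeasureTheory
open scoped ENNReal

noncomputable section

variable (p : ℕ) [Fact p.Prime]

instance padicMeasurableSpace : MeasurableSpace ℚ_[p] := borel _
instance padicBorelSpace : BorelSpace ℚ_[p] := ⟨rfl⟩

/-- The closed unit ball of `ℚ_[p]` as a positive compact set. -/
def padicUnitBall : TopologicalSpace.PositiveCompacts ℚ_[p] where
  carrier := Metric.closedBall 0 1
  isCompact' := isCompact_closedBall 0 1
  interior_nonempty' :=
    ⟨0, mem_interior_iff_mem_nhds.mpr
      (Filter.mem_of_superset (Metric.ball_mem_nhds 0 one_pos) Metric.ball_subset_closedBall)⟩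

/-- Haar measure on `ℚ_[p]` normalized so that `ℤ_p` has measure 1. -/
def padicHaar : Measure ℚ_[p] := Measure.addHaarMeasure (padicUnitBall p)

instance : SigmaFinite (padicHaar p) := by
  unfold padicHaar; infer_instance

/-- Normalized Haar measure on `ℚ_[p]^n` (the product measure), for which the
unit ball has measure 1. -/
def padicHaarPi (n : ℕ) : Measure (Fin n → ℚ_[p]) := Measure.pi fun _ => padicHaar p

/-- `ℤ_p^* = {t : 0 < |t|_p ≤ 1}`. -/
def Zpstar : Set ℚ_[p] := {t | t ≠ 0 ∧ ‖t‖ ≤ 1}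

/-- `(ℤ_p^*)^m`. -/
def ZpstarPi (m : ℕ) : Set (Fin m → ℚ_[p]) := Set.univ.pi fun _ => Zpstar p

/-- The sphere `S_k = {x ∈ ℚ_p^n : |x|_p = p^k}`. -/
def padicSphere (n : ℕ) (k : ℤ) : Set (Fin n → ℚ_[p]) := {x | ‖x‖ = (p : ℝ) ^ k}

/-- `‖f χ_k‖_{L^q}` for a nonnegative (ℝ≥0∞-valued) function. -/
def lqNormSphere (n : ℕ) (q : ℝ) (k : ℤ) (f : (Fin n → ℚ_[p]) → ℝ≥0∞) : ℝ≥0∞ :=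
  (∫⁻ x in padicSphere p n k, f x ^ q ∂ padicHaarPi p n) ^ (1 / q)

/-- The homogeneous p-adic Herz norm `‖f‖_{K̇^{α,r}_q}`. -/
def herzNorm (n : ℕ) (α r q : ℝ) (f : (Fin n → ℚ_[p]) → ℝ≥0∞) : ℝ≥0∞ :=
  (∑' k : ℤ, (p : ℝ≥0∞) ^ ((k : ℝ) * α * r) * lqNormSphere p n q k f ^ r) ^ (1 / r)

/-- The homogeneous p-adic Morrey–Herz norm `‖f‖_{MK̇^{α,λ}_{r,q}}`. -/
def morreyHerzNorm (n : ℕ) (α lam r q : ℝ) (f : (Fin n → ℚ_[p]) → ℝ≥0∞) : ℝ≥0∞ :=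
  ⨆ k₀ : ℤ, (p : ℝ≥0∞) ^ (-(k₀ : ℝ) * lam) *
    (∑' k : {k : ℤ // k ≤ k₀},
      (p : ℝ≥0∞) ^ (((k : ℤ) : ℝ) * α * r) * lqNormSphere p n q (k : ℤ) f ^ r) ^ (1 / r)

/-- The weighted multilinear p-adic Hardy operator `H^{p,m}_ψ`. -/
def multilinearHardy (n m : ℕ) (ψ : (Fin m → ℚ_[p]) → ℝ≥0∞)
    (f : Fin m → (Fin n → ℚ_[p]) → ℝ≥0∞) (x : Fin n → ℚ_[p]) : ℝ≥0∞ :=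
  ∫⁻ t in ZpstarPi p m, (∏ i, f i (t i • x)) * ψ t ∂ padicHaarPi p m

/-- The dual weighted multilinear p-adic Hardy operator `H^{p,m,*}_ψ`. -/
def multilinearHardyDual (n m : ℕ) (ψ : (Fin m → ℚ_[p]) → ℝ≥0∞)
    (f : Fin m → (Fin n → ℚ_[p]) → ℝ≥0∞) (x : Fin n → ℚ_[p]) : ℝ≥0∞ :=
  ∫⁻ t in ZpstarPi p m,
      (∏ i, f i ((((padicNormE (t i) : ℚ)⁻¹ : ℚ_[p])) • x)) *
        (∏ i, ENNReal.ofReal ‖t i‖ ^ (-(n : ℝ))) * ψ t ∂ padicHaarPi p m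


section Inequalities

variable {X T : Type*} [MeasurableSpace X] [MeasurableSpace T]

/-- If `w` dominates the `L^q` norms of the slices of `g`, its integral dominates the `L^q` norm of
the integrated function. -/
theorem lintegral_lintegral_rpow_le_of_le {μ : Measure X} [SFinite μ] {ν : Measure T} [SFinite ν]
    {q : ℝ} (hq : 1 < q) {g : T → X → ℝ≥0∞} (hg : Measurable (Function.uncurry g))
    {w : T → ℝ≥0∞} (hw : Measurable w) (hw0 : ∀ t, w t ≠ 0) (hwtop : ∫⁻ t, w t ∂ν ≠ ⊤)
    (hgw : ∀ t, ∫⁻ x, g t x ^ q ∂μ ≤ w t ^ q) :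
    ∫⁻ x, (∫⁻ t, g t x ∂ν) ^ q ∂μ ≤ (∫⁻ t, w t ∂ν) ^ q := by
  have hq0 : 0 < q := by linarith
  have hwfin : ∀ᵐ t ∂ν, w t < ⊤ := ae_lt_top hw hwtop
  have hconj : q.HolderConjugate (q / (q - 1)) := Real.HolderConjugate.conjExponent hq
  set s : ℝ := (q - 1) / q with hs
  have hpow : ∀ x : X, (∫⁻ t, g t x ∂ν) ^ q ≤
      (∫⁻ t, g t x ^ q * w t ^ (1 - q) ∂ν) * (∫⁻ t, w t ∂ν) ^ (q - 1) := by
    intro x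
    have hgx : Measurable fun t => g t x := hg.comp (measurable_id.prodMk measurable_const)
    have h1 : ∫⁻ t, g t x ∂ν = ∫⁻ t, ((fun t => g t x * w t ^ (-s)) * fun t => w t ^ s) t ∂ν := by
      refine lintegral_congr_ae (hwfin.mono fun t ht => ?_)
      simp only [Pi.mul_apply]
      rw [mul_assoc, ← ENNReal.rpow_add _ _ (hw0 t) ht.ne]
      simp
    have h2 := ENNReal.lintegral_mul_le_Lp_mul_Lq ν hconj (f := fun t => g t x * w t ^ (-s))
      (hgx.mul (hw.pow_const (-s))).aemeasurable (hw.pow_const s).aemeasurable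
    rw [← h1] at h2
    refine (ENNReal.rpow_le_rpow h2 hq0.le).trans (le_of_eq ?_)
    rw [ENNReal.mul_rpow_of_nonneg _ _ hq0.le, ← ENNReal.rpow_mul, ← ENNReal.rpow_mul]
    have hne : q - 1 ≠ 0 := by linarith
    congr 1
    · rw [one_div_mul_cancel hq0.ne', ENNReal.rpow_one]
      refine lintegral_congr fun t => ?_
      rw [ENNReal.mul_rpow_of_nonneg _ _ hq0.le, ← ENNReal.rpow_mul]
      congr 2
      rw [hs]; field_simp; ring
    · have e1 : 1 / (q / (q - 1)) * q = q - 1 := by field_simp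
      rw [e1]
      congr 1
      refine lintegral_congr fun t => ?_
      rw [← ENNReal.rpow_mul, hs]
      have : (q - 1) / q * (q / (q - 1)) = 1 := by field_simp
      rw [this, ENNReal.rpow_one]
  have hmeas : Measurable (Function.uncurry fun (x : X) (t : T) => g t x ^ q * w t ^ (1 - q)) :=
    ((hg.comp measurable_swap).pow_const q).mul ((hw.comp measurable_snd).pow_const _)
  calc ∫⁻ x, (∫⁻ t, g t x ∂ν) ^ q ∂μ
      ≤ ∫⁻ x, (∫⁻ t, g t x ^ q * w t ^ (1 - q) ∂ν) * (∫⁻ t, w t ∂ν) ^ (q - 1) ∂μ :=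
        lintegral_mono hpow
    _ = (∫⁻ t, ∫⁻ x, g t x ^ q * w t ^ (1 - q) ∂μ ∂ν) * (∫⁻ t, w t ∂ν) ^ (q - 1) := by
        rw [lintegral_mul_const _ hmeas.lintegral_prod_right,
          lintegral_lintegral_swap hmeas.aemeasurable]
    _ ≤ (∫⁻ t, w t ∂ν) * (∫⁻ t, w t ∂ν) ^ (q - 1) := by
        gcongr ?_ * _
        refine lintegral_mono_ae (hwfin.mono fun t ht => ?_)
        have hgt : Measurable fun x => g t x := hg.comp (measurable_const.prodMk measurable_id)
        rw [lintegral_mul_const _ (hgt.pow_const q)]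
        refine (mul_le_mul_left (hgw t) _).trans (le_of_eq ?_)
        rw [← ENNReal.rpow_add _ _ (hw0 t) ht.ne]
        simp
    _ = (∫⁻ t, w t ∂ν) ^ q := by
        nth_rewrite 1 [← ENNReal.rpow_one (∫⁻ t, w t ∂ν)]
        rw [← ENNReal.rpow_add_of_nonneg _ _ zero_le_one (by linarith)]
        congr 1; ring

/-- **Minkowski's integral inequality**. -/
theorem lintegral_lintegral_rpow_le {μ : Measure X} [SFinite μ] {ν : Measure T} [SigmaFinite ν]
    {q : ℝ} (hq : 1 < q) {g : T → X → ℝ≥0∞} (hg : Measurable (Function.uncurry g)) :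
    (∫⁻ x, (∫⁻ t, g t x ∂ν) ^ q ∂μ) ^ (1 / q) ≤ ∫⁻ t, (∫⁻ x, g t x ^ q ∂μ) ^ (1 / q) ∂ν := by
  have hq0 : 0 < q := by linarith
  have hW : Measurable fun t => (∫⁻ x, g t x ^ q ∂μ) ^ (1 / q) :=
    Measurable.pow_const (Measurable.lintegral_prod_right (f := fun t x => g t x ^ q)
      (hg.pow_const q)) (1 / q)
  refine ENNReal.le_of_forall_pos_le_add fun ε hε hfin => ?_
  obtain ⟨δ, hδ0, hδ, hδε⟩ := exists_pos_lintegral_lt_of_sigmaFinite ν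
    (ε := (ε : ℝ≥0∞)) (by exact_mod_cast hε.ne')
  have hsum : ∫⁻ t, ((∫⁻ x, g t x ^ q ∂μ) ^ (1 / q) + δ t) ∂ν ≤
      (∫⁻ t, (∫⁻ x, g t x ^ q ∂μ) ^ (1 / q) ∂ν) + ε := by
    rw [lintegral_add_left hW]
    gcongr
  refine le_trans ?_ hsum
  simp only [one_div] at hW hsum hfin ⊢
  rw [ENNReal.rpow_inv_le_iff hq0]
  refine lintegral_lintegral_rpow_le_of_le hq hg (hW.add hδ.coe_nnreal_ennreal :)
    (fun t => ?_) (ne_top_of_le_ne_top (by finiteness) hsum) fun t => ?_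
  · simp [(hδ0 t).ne']
  · rw [← ENNReal.rpow_inv_le_iff hq0, ← one_div]
    exact le_self_add

/-- Hölder's inequality for the `L^s` quasi-norm of a product of `m` functions, measured in
`L^{ms}`. -/
theorem lintegral_prod_rpow_le {μ : Measure X} {m : ℕ} (hm : 1 ≤ m) {s : ℝ} (hs : 0 < s)
    {f : Fin m → X → ℝ≥0∞} (hf : ∀ i, Measurable (f i)) :
    (∫⁻ x, (∏ i, f i x) ^ s ∂μ) ^ (1 / s) ≤
      ∏ i, (∫⁻ x, f i x ^ ((m : ℝ) * s) ∂μ) ^ (1 / ((m : ℝ) * s)) := by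
  have hm0 : (0 : ℝ) < m := by exact_mod_cast hm
  have h := ENNReal.lintegral_prod_norm_pow_le (μ := μ) Finset.univ
    (f := fun i x => f i x ^ ((m : ℝ) * s)) (fun i _ => ((hf i).pow_const _).aemeasurable)
    (p := fun _ => 1 / (m : ℝ)) (by simp [hm0.ne']) (fun _ _ => by positivity)
  have e : ∀ x, ∏ i, (f i x ^ ((m : ℝ) * s)) ^ (1 / (m : ℝ)) = (∏ i, f i x) ^ s := by
    intro x
    rw [← ENNReal.prod_rpow_of_nonneg hs.le]
    refine Finset.prod_congr rfl fun i _ => ?_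
    rw [← ENNReal.rpow_mul]
    congr 1; field_simp
  simp only [e] at h
  refine (ENNReal.rpow_le_rpow h (by positivity)).trans (le_of_eq ?_)
  rw [← ENNReal.prod_rpow_of_nonneg (by positivity)]
  refine Finset.prod_congr rfl fun i _ => ?_
  rw [← ENNReal.rpow_mul]
  congr 1; field_simp

end Inequalities

theorem padicHaar_map_mul (t : ℚ_[p]) (ht : t ≠ 0) :
    (padicHaar p).map (fun x => t * x) =
      padicHaar p (Metric.closedBall 0 ‖t‖⁻¹) • padicHaar p := by
  have : (padicHaar p).IsAddHaarMeasure := by unfold padicHaar; infer_instance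
  have : ((padicHaar p).map (fun x => t * x)).IsAddHaarMeasure :=
    (ContinuousLinearEquiv.smulLeft (R₁ := ℚ_[p]) (M₁ := ℚ_[p])
      (Units.mk0 t ht)).isAddHaarMeasure_map (padicHaar p)
  have h := Measure.addHaarMeasure_unique ((padicHaar p).map (fun x => t * x)) (padicUnitBall p)
  have hball : (padicHaar p).map (fun x => t * x) (padicUnitBall p) =
      padicHaar p (Metric.closedBall 0 ‖t‖⁻¹) := by
    change (padicHaar p).map (fun x => t * x) (Metric.closedBall 0 1) = _
    rw [Measure.map_apply (measurable_const_mul t) measurableSet_closedBall]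
    congr 1
    ext x
    have : 0 < ‖t‖ := norm_pos_iff.mpr ht
    simp only [Set.mem_preimage, mem_closedBall_zero_iff, norm_mul]
    rw [← one_div, le_div_iff₀ this, mul_comm]
  rw [hball] at h
  exact h

theorem padicHaar_closedBall_one : padicHaar p (Metric.closedBall 0 1) = 1 :=
  Measure.addHaarMeasure_self (K₀ := padicUnitBall p)

theorem padicHaar_closedBall_inv :
    (p : ℝ≥0∞) * padicHaar p (Metric.closedBall 0 (p : ℝ)⁻¹) = 1 := by
  have : (padicHaar p).IsAddHaarMeasure := by unfold padicHaar; infer_instance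
  have hp : (1 : ℝ) < p := by exact_mod_cast (Fact.out : p.Prime).one_lt
  have hinv : (p : ℝ)⁻¹ < 1 := inv_lt_one_of_one_lt₀ hp
  have hunion : Metric.closedBall (0 : ℚ_[p]) 1 =
      ⋃ j ∈ Finset.range p, Metric.closedBall (j : ℚ_[p]) (p : ℝ)⁻¹ := by
    ext x
    simp only [Set.mem_iUnion, Finset.mem_range, Metric.mem_closedBall, dist_eq_norm, sub_zero,
      exists_prop]
    constructor
    · intro hx
      obtain ⟨y, rfl⟩ : ∃ y : ℤ_[p], (y : ℚ_[p]) = x := ⟨⟨x, hx⟩, rfl⟩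
      obtain ⟨j, hj, hjx⟩ := PadicInt.exists_mem_range y
      refine ⟨j, hj, ?_⟩
      rw [PadicInt.maximalIdeal_eq_span_p, show (p : ℤ_[p]) = (p : ℤ_[p]) ^ 1 from (pow_one _).symm,
        ← PadicInt.norm_le_pow_iff_mem_span_pow] at hjx
      rw [PadicInt.norm_def] at hjx
      push_cast at hjx
      rwa [zpow_neg_one] at hjx
    · rintro ⟨j, -, hjx⟩
      have := Padic.nonarchimedean (x - (j : ℚ_[p])) (j : ℚ_[p])
      rw [sub_add_cancel] at this
      refine this.trans (max_le (hjx.trans hinv.le) ?_)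
      exact_mod_cast Padic.norm_int_le_one (p := p) j
  have hdisj : (Finset.range p : Set ℕ).PairwiseDisjoint
      fun j : ℕ => Metric.closedBall (j : ℚ_[p]) (p : ℝ)⁻¹ := by
    intro i hi j hj hij
    refine Set.disjoint_left.mpr fun x hxi hxj => hij ?_
    have hd : ‖((i - j : ℤ) : ℚ_[p])‖ < 1 := by
      have h1 : dist (i : ℚ_[p]) j ≤ max (dist (i : ℚ_[p]) x) (dist x j) := dist_triangle_max _ _ _
      rw [dist_comm _ x] at h1
      push_cast
      rw [← dist_eq_norm]
      exact (h1.trans (max_le hxi hxj)).trans_lt hinv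
    rw [Padic.norm_intCast_lt_one_iff] at hd
    simp only [Finset.coe_range, Set.mem_Iio] at hi hj
    have := (Nat.modEq_iff_dvd.mpr (by simpa using hd) : j ≡ i [MOD p])
    exact (this.eq_of_lt_of_lt hj hi).symm
  have := padicHaar_closedBall_one p
  rw [hunion, measure_biUnion_finset hdisj fun _ _ => measurableSet_closedBall] at this
  have htrans : ∀ j : ℚ_[p], padicHaar p (Metric.closedBall j (p : ℝ)⁻¹) =
      padicHaar p (Metric.closedBall 0 (p : ℝ)⁻¹) := fun j =>
    Measure.addHaar_closedBall_center _ _ _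
  simpa [htrans] using this

theorem padicHaar_closedBall_zpow (k : ℤ) :
    padicHaar p (Metric.closedBall 0 ((p : ℝ) ^ k)) = (p : ℝ≥0∞) ^ k := by
  have hp0 : (p : ℚ_[p]) ≠ 0 := by exact_mod_cast (Fact.out : p.Prime).ne_zero
  have hpR : (0 : ℝ) < p := by exact_mod_cast (Fact.out : p.Prime).pos
  have hpE : (p : ℝ≥0∞) ≠ 0 := by exact_mod_cast (Fact.out : p.Prime).ne_zero
  have hpT : (p : ℝ≥0∞) ≠ ⊤ := ENNReal.natCast_ne_top p
  have hstep : ∀ R : ℝ, padicHaar p (Metric.closedBall 0 R) =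
      (p : ℝ≥0∞) * padicHaar p (Metric.closedBall 0 (R * (p : ℝ)⁻¹)) := by
    have hmap : ∀ R : ℝ, padicHaar p (Metric.closedBall 0 R) =
        padicHaar p (Metric.closedBall 0 (p : ℝ)) *
          padicHaar p (Metric.closedBall 0 (R * (p : ℝ)⁻¹)) := by
      intro R
      have h := congrArg (fun μ : Measure ℚ_[p] => μ (Metric.closedBall 0 (R * (p : ℝ)⁻¹)))
        (padicHaar_map_mul p p hp0)
      simp only [Measure.smul_apply, smul_eq_mul, Padic.norm_p, inv_inv] at h
      rw [Measure.map_apply (measurable_const_mul _) measurableSet_closedBall] at h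
      rw [← h]
      congr 1
      ext x
      simp only [Set.mem_preimage, mem_closedBall_zero_iff, norm_mul, Padic.norm_p]
      rw [mul_comm R, mul_le_mul_iff_right₀ (by positivity)]
    have h1 := hmap 1
    rw [padicHaar_closedBall_one, one_mul] at h1
    have h2 := padicHaar_closedBall_inv p
    intro R
    rw [hmap R]
    congr 1
    rw [ENNReal.eq_inv_of_mul_eq_one_left h1.symm, ENNReal.eq_inv_of_mul_eq_one_left h2]
  induction k using Int.induction_on with
  | zero => simpa using padicHaar_closedBall_one p
  | succ k ih =>
    rw [hstep, ← zpow_sub_one₀ hpR.ne', add_sub_cancel_right, ih, ENNReal.zpow_add hpE hpT,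
      zpow_one, mul_comm]
  | pred k ih =>
    rw [hstep, ← zpow_sub_one₀ hpR.ne'] at ih
    rw [sub_eq_add_neg (-(k : ℤ)), ENNReal.zpow_add hpE hpT, ← ih, ← sub_eq_add_neg, mul_comm,
      ← mul_assoc, zpow_neg_one, ENNReal.inv_mul_cancel hpE hpT, one_mul]

theorem padicHaarPi_map_smul (n : ℕ) {t : ℚ_[p]} {v : ℤ} (ht : ‖t‖ = (p : ℝ) ^ v) :
    (padicHaarPi p n).map (fun x => t • x) = ((p : ℝ≥0∞) ^ (-v)) ^ n • padicHaarPi p n := by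
  have hpR : (0 : ℝ) < p := by exact_mod_cast (Fact.out : p.Prime).pos
  have hpE : (p : ℝ≥0∞) ≠ 0 := by exact_mod_cast (Fact.out : p.Prime).ne_zero
  have hpT : (p : ℝ≥0∞) ≠ ⊤ := ENNReal.natCast_ne_top p
  have ht0 : t ≠ 0 := norm_pos_iff.mp (ht ▸ zpow_pos hpR v)
  have h1 : (padicHaar p).map (fun x => t * x) = (p : ℝ≥0∞) ^ (-v) • padicHaar p := by
    rw [padicHaar_map_mul p t ht0, ht, ← zpow_neg, padicHaar_closedBall_zpow]
  have hvv : (p : ℝ≥0∞) ^ v * (p : ℝ≥0∞) ^ (-v) = 1 := by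
    rw [← ENNReal.zpow_add hpE hpT, add_neg_cancel, zpow_zero]
  have h2 : padicHaarPi p n =
      ((p : ℝ≥0∞) ^ v) ^ n • (padicHaarPi p n).map (fun x => t • x) := by
    refine Measure.pi_eq fun s hs => ?_
    rw [Measure.smul_apply, Measure.map_apply (measurable_const_smul t)
      (MeasurableSet.univ_pi hs)]
    have hpre : (fun x : Fin n → ℚ_[p] => t • x) ⁻¹' (Set.univ.pi s) =
        Set.univ.pi fun i => (fun x => t * x) ⁻¹' s i := by
      ext x; simp
    have hcoord : ∀ i, padicHaar p ((fun x => t * x) ⁻¹' s i) =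
        (p : ℝ≥0∞) ^ (-v) * padicHaar p (s i) := by
      intro i
      rw [← Measure.map_apply (measurable_const_mul t) (hs i), h1]; rfl
    rw [hpre, padicHaarPi, Measure.pi_pi]
    simp only [hcoord, Finset.prod_mul_distrib, Finset.prod_const, Finset.card_univ,
      Fintype.card_fin, smul_eq_mul]
    rw [← mul_assoc, ← mul_pow, hvv, one_pow, one_mul]
  nth_rewrite 2 [h2]
  rw [smul_smul, ← mul_pow, mul_comm, hvv, one_pow, one_smul]

theorem measurableSet_padicSphere (n : ℕ) (k : ℤ) : MeasurableSet (padicSphere p n k) :=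
  measurable_norm (measurableSet_singleton _)

instance (n : ℕ) : SigmaFinite (padicHaarPi p n) := by
  unfold padicHaarPi; infer_instance

theorem lqNormSphere_smul (n : ℕ) {q : ℝ} (hq : 0 < q) (k : ℤ) {t : ℚ_[p]} {v : ℤ}
    (ht : ‖t‖ = (p : ℝ) ^ v) {f : (Fin n → ℚ_[p]) → ℝ≥0∞} (hf : Measurable f) :
    lqNormSphere p n q k (fun x => f (t • x)) =
      (p : ℝ≥0∞) ^ (-(v : ℝ) * ((n : ℝ) / q)) * lqNormSphere p n q (k + v) f := by
  have hpR : (0 : ℝ) < p := by exact_mod_cast (Fact.out : p.Prime).pos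
  have hpre : (fun x : Fin n → ℚ_[p] => t • x) ⁻¹' padicSphere p n (k + v) = padicSphere p n k := by
    ext x
    simp only [padicSphere, Set.mem_preimage, Set.mem_ofPred_eq, norm_smul, ht]
    rw [zpow_add₀ hpR.ne', mul_comm (_ ^ k)]
    exact mul_right_inj' (zpow_pos hpR v).ne'
  have h := setLIntegral_map (μ := padicHaarPi p n) (measurableSet_padicSphere p n (k + v))
    (hf.pow_const q) (measurable_const_smul t)
  rw [hpre, padicHaarPi_map_smul p n ht, Measure.restrict_smul, lintegral_smul_measure] at h
  rw [lqNormSphere, ← h, smul_eq_mul, ENNReal.mul_rpow_of_nonneg _ _ (by positivity), lqNormSphere,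
    ← ENNReal.rpow_intCast, ← ENNReal.rpow_natCast, ← ENNReal.rpow_mul, ← ENNReal.rpow_mul]
  congr 2
  push_cast
  ring

/-- The truncated Herz norm, summing only over the spheres of radius at most `p ^ k₀`. -/
def truncHerzNorm (n : ℕ) (α r q : ℝ) (k₀ : ℤ) (f : (Fin n → ℚ_[p]) → ℝ≥0∞) : ℝ≥0∞ :=
  (∑' k : {k : ℤ // k ≤ k₀},
    (p : ℝ≥0∞) ^ (((k : ℤ) : ℝ) * α * r) * lqNormSphere p n q (k : ℤ) f ^ r) ^ (1 / r)

theorem truncHerzNorm_eq_lintegral (n : ℕ) {α r q : ℝ} (hr : 0 < r) (k₀ : ℤ)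
    (f : (Fin n → ℚ_[p]) → ℝ≥0∞) :
    truncHerzNorm p n α r q k₀ f =
      (∫⁻ k : {k : ℤ // k ≤ k₀},
        ((p : ℝ≥0∞) ^ (((k : ℤ) : ℝ) * α) * lqNormSphere p n q (k : ℤ) f) ^ r
          ∂Measure.count) ^ (1 / r) := by
  rw [truncHerzNorm, lintegral_count]
  congr 2
  ext k
  rw [ENNReal.mul_rpow_of_nonneg _ _ hr.le, ← ENNReal.rpow_mul]

theorem truncHerzNorm_le (n : ℕ) {α lam r q : ℝ} (k₀ : ℤ) (f : (Fin n → ℚ_[p]) → ℝ≥0∞) :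
    truncHerzNorm p n α r q k₀ f ≤
      (p : ℝ≥0∞) ^ ((k₀ : ℝ) * lam) * morreyHerzNorm p n α lam r q f := by
  have hpE : (p : ℝ≥0∞) ≠ 0 := by exact_mod_cast (Fact.out : p.Prime).ne_zero
  have hpT : (p : ℝ≥0∞) ≠ ⊤ := ENNReal.natCast_ne_top p
  have h : (p : ℝ≥0∞) ^ (-(k₀ : ℝ) * lam) * truncHerzNorm p n α r q k₀ f ≤
      morreyHerzNorm p n α lam r q f :=
    le_iSup (fun k₀ : ℤ => (p : ℝ≥0∞) ^ (-(k₀ : ℝ) * lam) * truncHerzNorm p n α r q k₀ f) k₀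
  refine le_trans (le_of_eq ?_) (mul_le_mul_right h _)
  rw [← mul_assoc, ← ENNReal.rpow_add _ _ hpE hpT]
  simp

theorem truncHerzNorm_smul_le (n : ℕ) {α lam r q : ℝ} (hr : 0 < r) (hq : 0 < q) (k₀ : ℤ)
    {t : ℚ_[p]} (ht : t ≠ 0) {f : (Fin n → ℚ_[p]) → ℝ≥0∞} (hf : Measurable f) :
    truncHerzNorm p n α r q k₀ (fun x => f (t • x)) ≤
      ENNReal.ofReal ‖t‖ ^ (-(α + (n : ℝ) / q - lam)) *
        ((p : ℝ≥0∞) ^ ((k₀ : ℝ) * lam) * morreyHerzNorm p n α lam r q f) := by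
  have hpR : (0 : ℝ) < p := by exact_mod_cast (Fact.out : p.Prime).pos
  have hpE : (p : ℝ≥0∞) ≠ 0 := by exact_mod_cast (Fact.out : p.Prime).ne_zero
  have hpT : (p : ℝ≥0∞) ≠ ⊤ := ENNReal.natCast_ne_top p
  obtain ⟨v, hv⟩ : ∃ v : ℤ, ‖t‖ = (p : ℝ) ^ v := ⟨_, Padic.norm_eq_zpow_neg_valuation ht⟩
  have hnorm : ENNReal.ofReal ‖t‖ = (p : ℝ≥0∞) ^ (v : ℝ) := by
    rw [hv, ← Real.rpow_intCast, ← ENNReal.ofReal_rpow_of_pos hpR, ENNReal.ofReal_natCast]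
  let e : {k : ℤ // k ≤ k₀} ≃ {k : ℤ // k ≤ k₀ + v} :=
    (Equiv.addRight v).subtypeEquiv fun a => by simp
  have hshift : truncHerzNorm p n α r q k₀ (fun x => f (t • x)) =
      (p : ℝ≥0∞) ^ (-(v : ℝ) * ((n : ℝ) / q + α)) * truncHerzNorm p n α r q (k₀ + v) f := by
    rw [truncHerzNorm, truncHerzNorm, ← e.tsum_eq]
    have hterm : ∀ k : {k : ℤ // k ≤ k₀}, (p : ℝ≥0∞) ^ (((k : ℤ) : ℝ) * α * r) *
        lqNormSphere p n q (k : ℤ) (fun x => f (t • x)) ^ r =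
        ((p : ℝ≥0∞) ^ (-(v : ℝ) * ((n : ℝ) / q + α))) ^ r *
          ((p : ℝ≥0∞) ^ (((e k : ℤ) : ℝ) * α * r) * lqNormSphere p n q (e k : ℤ) f ^ r) := by
      intro k
      have hek : ((e k : ℤ)) = k + v := rfl
      rw [lqNormSphere_smul p n hq _ hv hf, hek, ENNReal.mul_rpow_of_nonneg _ _ hr.le,
        ← ENNReal.rpow_mul, ← ENNReal.rpow_mul, ← mul_assoc, ← mul_assoc,
        ← ENNReal.rpow_add _ _ hpE hpT, ← ENNReal.rpow_add _ _ hpE hpT]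
      congr 2
      push_cast
      ring
    simp only [hterm]
    rw [ENNReal.tsum_mul_left, ENNReal.mul_rpow_of_nonneg _ _ (by positivity), one_div,
      ENNReal.rpow_rpow_inv hr.ne']
  rw [hshift]
  refine (mul_le_mul_right (truncHerzNorm_le p n (lam := lam) (k₀ + v) f) _).trans (le_of_eq ?_)
  rw [hnorm, ← mul_assoc, ← mul_assoc, ← ENNReal.rpow_mul, ← ENNReal.rpow_add _ _ hpE hpT,
    ← ENNReal.rpow_add _ _ hpE hpT]
  congr 2
  push_cast
  ring

theorem truncHerzNorm_prod_le (n : ℕ) {m : ℕ} (hm : 1 ≤ m) {α r q : ℝ} (hr : 0 < r) (hq : 0 < q)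
    (k₀ : ℤ) {f : Fin m → (Fin n → ℚ_[p]) → ℝ≥0∞} (hf : ∀ i, Measurable (f i)) :
    truncHerzNorm p n α r q k₀ (fun x => ∏ i, f i x) ≤
      ∏ i, truncHerzNorm p n (α / m) ((m : ℝ) * r) ((m : ℝ) * q) k₀ (f i) := by
  have hpE : (p : ℝ≥0∞) ≠ 0 := by exact_mod_cast (Fact.out : p.Prime).ne_zero
  have hpT : (p : ℝ≥0∞) ≠ ⊤ := ENNReal.natCast_ne_top p
  have hm0 : (0 : ℝ) < m := by exact_mod_cast hm
  simp only [truncHerzNorm_eq_lintegral p n hr,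
    truncHerzNorm_eq_lintegral p n (mul_pos hm0 hr)]
  refine le_trans ?_ (lintegral_prod_rpow_le hm hr fun i => measurable_of_countable _)
  gcongr with k
  rw [Finset.prod_mul_distrib, Finset.prod_const, Finset.card_univ, Fintype.card_fin,
    ← ENNReal.rpow_natCast, ← ENNReal.rpow_mul]
  have : ((k : ℤ) : ℝ) * (α / m) * m = (k : ℤ) * α := by field_simp
  rw [this]
  gcongr
  exact lintegral_prod_rpow_le hm hq hf

/-- **Minkowski's integral inequality** for the truncated Herz norm. -/
theorem truncHerzNorm_lintegral_le {T : Type*} [MeasurableSpace T] {ν : Measure T} [SigmaFinite ν]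
    (n : ℕ) {α r q : ℝ} (hr : 1 < r) (hq : 1 < q) (k₀ : ℤ)
    {g : T → (Fin n → ℚ_[p]) → ℝ≥0∞} (hg : Measurable (Function.uncurry g)) :
    truncHerzNorm p n α r q k₀ (fun x => ∫⁻ t, g t x ∂ν) ≤
      ∫⁻ t, truncHerzNorm p n α r q k₀ (g t) ∂ν := by
  have hr0 : 0 < r := by linarith
  have hN : ∀ k : ℤ, Measurable fun t => lqNormSphere p n q k (g t) := fun k =>
    Measurable.pow_const (Measurable.lintegral_prod_right (f := fun t x => g t x ^ q)
      (hg.pow_const q)) (1 / q)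
  simp only [truncHerzNorm_eq_lintegral p n hr0]
  refine le_trans ?_ (lintegral_lintegral_rpow_le hr (ν := ν)
    (g := fun t (k : {k : ℤ // k ≤ k₀}) =>
      (p : ℝ≥0∞) ^ (((k : ℤ) : ℝ) * α) * lqNormSphere p n q (k : ℤ) (g t))
    (measurable_from_prod_countable_left fun k =>
      (hN k).const_mul ((p : ℝ≥0∞) ^ (((k : ℤ) : ℝ) * α))))
  gcongr with k
  rw [lintegral_const_mul _ (hN k)]
  gcongr
  exact lintegral_lintegral_rpow_le hq hg

theorem truncHerzNorm_mul_const (n : ℕ) {α r q : ℝ} (hr : 0 < r) (hq : 0 < q) (k₀ : ℤ)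
    (c : ℝ≥0∞) {f : (Fin n → ℚ_[p]) → ℝ≥0∞} (hf : Measurable f) :
    truncHerzNorm p n α r q k₀ (fun x => f x * c) = truncHerzNorm p n α r q k₀ f * c := by
  have hN : ∀ k : ℤ, lqNormSphere p n q k (fun x => f x * c) = lqNormSphere p n q k f * c := by
    intro k
    simp only [lqNormSphere, ENNReal.mul_rpow_of_nonneg _ _ hq.le]
    rw [lintegral_mul_const _ (hf.pow_const q), ENNReal.mul_rpow_of_nonneg _ _ (by positivity),
      one_div, ENNReal.rpow_rpow_inv hq.ne']
  simp only [truncHerzNorm, hN, ENNReal.mul_rpow_of_nonneg _ _ hr.le, ← mul_assoc]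
  rw [ENNReal.tsum_mul_right, ENNReal.mul_rpow_of_nonneg _ _ (by positivity), one_div,
    ENNReal.rpow_rpow_inv hr.ne']

theorem measurableSet_ZpstarPi (m : ℕ) : MeasurableSet (ZpstarPi p m) :=
  MeasurableSet.univ_pi fun _ =>
    (measurableSet_singleton (0 : ℚ_[p])).compl.inter
      (measurableSet_le measurable_norm measurable_const)

/-- The upper bound for the weighted multilinear Hardy operator. -/
theorem morreyHerzNorm_multilinearHardy_le (n : ℕ) {m : ℕ} (hm : 1 ≤ m) {α lam r q : ℝ}
    (hr : 1 < r) (hq : 1 < q) {ψ : (Fin m → ℚ_[p]) → ℝ≥0∞} (hψ : Measurable ψ)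
    {f : Fin m → (Fin n → ℚ_[p]) → ℝ≥0∞} (hf : ∀ i, Measurable (f i)) :
    morreyHerzNorm p n α lam r q (multilinearHardy p n m ψ f) ≤
      (∫⁻ t in ZpstarPi p m,
        (∏ i, ENNReal.ofReal ‖t i‖ ^ (-(α / m + (n : ℝ) / ((m : ℝ) * q) - lam / m))) * ψ t
          ∂ padicHaarPi p m) *
        ∏ i, morreyHerzNorm p n (α / m) (lam / m) ((m : ℝ) * r) ((m : ℝ) * q) (f i) := by
  have hpE : (p : ℝ≥0∞) ≠ 0 := by exact_mod_cast (Fact.out : p.Prime).ne_zero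
  have hpT : (p : ℝ≥0∞) ≠ ⊤ := ENNReal.natCast_ne_top p
  have hm0 : (0 : ℝ) < m := by exact_mod_cast hm
  have hr0 : 0 < r := by linarith
  have hq0 : 0 < q := by linarith
  refine iSup_le fun k₀ => ?_
  change (p : ℝ≥0∞) ^ (-(k₀ : ℝ) * lam) * truncHerzNorm p n α r q k₀ _ ≤ _
  have hsmul : ∀ i, Measurable fun z : (Fin m → ℚ_[p]) × (Fin n → ℚ_[p]) => f i (z.1 i • z.2) :=
    fun i => (hf i).comp (((measurable_pi_apply i).comp measurable_fst).smul measurable_snd)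
  have hg : Measurable (Function.uncurry fun (t : Fin m → ℚ_[p]) (x : Fin n → ℚ_[p]) =>
      (∏ i, f i (t i • x)) * ψ t) :=
    (Finset.measurable_fun_prod _ fun i _ => hsmul i).mul (hψ.comp measurable_fst)
  have hslice : ∀ t ∈ ZpstarPi p m,
      truncHerzNorm p n α r q k₀ (fun x => (∏ i, f i (t i • x)) * ψ t) ≤
      (∏ i, ENNReal.ofReal ‖t i‖ ^ (-(α / m + (n : ℝ) / ((m : ℝ) * q) - lam / m))) * ψ t *
        ((p : ℝ≥0∞) ^ ((k₀ : ℝ) * lam) *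
          ∏ i, morreyHerzNorm p n (α / m) (lam / m) ((m : ℝ) * r) ((m : ℝ) * q) (f i)) := by
    intro t ht
    have hft : ∀ i, Measurable fun x => f i (t i • x) := fun i =>
      (hf i).comp (measurable_const_smul _)
    rw [truncHerzNorm_mul_const p n hr0 hq0 _ _ (Finset.measurable_fun_prod _ fun i _ => hft i)]
    calc truncHerzNorm p n α r q k₀ (fun x => ∏ i, f i (t i • x)) * ψ t
        ≤ (∏ i, ENNReal.ofReal ‖t i‖ ^ (-(α / m + (n : ℝ) / ((m : ℝ) * q) - lam / m)) *
            ((p : ℝ≥0∞) ^ ((k₀ : ℝ) * (lam / m)) *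
              morreyHerzNorm p n (α / m) (lam / m) ((m : ℝ) * r) ((m : ℝ) * q) (f i))) * ψ t := by
          gcongr ?_ * _
          refine (truncHerzNorm_prod_le p n hm hr0 hq0 k₀ hft).trans
            (Finset.prod_le_prod' fun i _ => ?_)
          exact truncHerzNorm_smul_le p n (mul_pos hm0 hr0) (mul_pos hm0 hq0) k₀
            (ht i (Set.mem_univ i)).1 (hf i)
      _ = _ := by
          rw [Finset.prod_mul_distrib, Finset.prod_mul_distrib, Finset.prod_const,
            Finset.card_univ, Fintype.card_fin, ← ENNReal.rpow_natCast, ← ENNReal.rpow_mul]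
          have : (k₀ : ℝ) * (lam / m) * m = k₀ * lam := by field_simp
          rw [this]
          ring
  have hw : Measurable fun t : Fin m → ℚ_[p] =>
      (∏ i, ENNReal.ofReal ‖t i‖ ^ (-(α / m + (n : ℝ) / ((m : ℝ) * q) - lam / m))) * ψ t :=
    (Finset.measurable_fun_prod _ fun i _ =>
      ((measurable_pi_apply i).norm.ennreal_ofReal).pow_const _).mul hψ
  have h := (truncHerzNorm_lintegral_le p n (ν := (padicHaarPi p m).restrict (ZpstarPi p m))
    (α := α) hr hq k₀ hg).trans (setLIntegral_mono' (measurableSet_ZpstarPi p m) hslice)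
  rw [lintegral_mul_const _ hw] at h
  refine (mul_le_mul_right h _).trans (le_of_eq ?_)
  rw [mul_left_comm, ← mul_assoc ((p : ℝ≥0∞) ^ _), ← ENNReal.rpow_add _ _ hpE hpT]
  simp

theorem padicHaarPi_padicSphere_zero_ne_zero {n : ℕ} (hn : 1 ≤ n) :
    padicHaarPi p n (padicSphere p n 0) ≠ 0 := by
  have : (padicHaar p).IsAddHaarMeasure := by unfold padicHaar; infer_instance
  have hopen : IsOpen (padicSphere p n 0) := by
    have h : padicSphere p n 0 = Metric.sphere 0 1 := by
      ext x; simp [padicSphere]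
    rw [h]
    exact IsUltrametricDist.isOpen_sphere _ one_ne_zero
  have : Nonempty (Fin n) := ⟨⟨0, hn⟩⟩
  have hne : (padicSphere p n 0).Nonempty := ⟨fun _ => 1, by simp [padicSphere]⟩
  unfold padicHaarPi
  exact hopen.measure_ne_zero _ hne

theorem padicHaarPi_padicSphere_zero_ne_top (n : ℕ) :
    padicHaarPi p n (padicSphere p n 0) ≠ ⊤ := by
  have : (padicHaar p).IsAddHaarMeasure := by unfold padicHaar; infer_instance
  have hsub : padicSphere p n 0 ⊆ Metric.closedBall 0 1 := fun x hx => by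
    have : ‖x‖ = 1 := by simpa [padicSphere] using hx
    simp [this]
  unfold padicHaarPi
  exact ne_top_of_le_ne_top (isCompact_closedBall _ _).measure_lt_top.ne (measure_mono hsub)

theorem lqNormSphere_one (n : ℕ) {q : ℝ} (hq : 0 < q) (k : ℤ) :
    lqNormSphere p n q k (fun _ => 1) =
      (p : ℝ≥0∞) ^ ((k : ℝ) * ((n : ℝ) / q)) *
        padicHaarPi p n (padicSphere p n 0) ^ (1 / q) := by
  have hnorm : ‖(p : ℚ_[p]) ^ k‖ = (p : ℝ) ^ (-k) := Padic.norm_p_zpow k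
  have h := lqNormSphere_smul p n hq k hnorm (f := fun _ => 1) measurable_const
  rw [add_neg_cancel] at h
  rw [h, lqNormSphere]
  simp

/-- The sum `∑_{k ≤ 0} p ^ (k s)` is positive and finite. -/
theorem tsum_rpow_nonpos_ne_zero_and_ne_top {s : ℝ} (hs : 0 < s) :
    ∑' k : {k : ℤ // k ≤ 0}, (p : ℝ≥0∞) ^ (((k : ℤ) : ℝ) * s) ≠ 0 ∧
      ∑' k : {k : ℤ // k ≤ 0}, (p : ℝ≥0∞) ^ (((k : ℤ) : ℝ) * s) ≠ ⊤ := by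
  have hp1 : (1 : ℝ≥0∞) < p := by exact_mod_cast (Fact.out : p.Prime).one_lt
  refine ⟨fun h0 => ?_, ?_⟩
  · have h := ENNReal.le_tsum (f := fun k : {k : ℤ // k ≤ 0} =>
      (p : ℝ≥0∞) ^ (((k : ℤ) : ℝ) * s)) ⟨0, le_rfl⟩
    rw [h0] at h
    simp at h
  · let e : ℕ ≃ {k : ℤ // k ≤ 0} :=
      { toFun := fun j => ⟨-j, by simp⟩
        invFun := fun k => (-(k : ℤ)).toNat
        left_inv := fun j => by simp
        right_inv := fun k => by ext; simp [k.2] }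
    rw [← e.tsum_eq]
    have : ∀ j : ℕ, (p : ℝ≥0∞) ^ (((e j : ℤ) : ℝ) * s) = ((p : ℝ≥0∞) ^ (-s)) ^ j := by
      intro j
      rw [← ENNReal.rpow_natCast, ← ENNReal.rpow_mul]
      congr 1
      simp [e, mul_comm]
    simp only [this]
    rw [ENNReal.tsum_geometric]
    have hlt : (p : ℝ≥0∞) ^ (-s) < 1 := ENNReal.rpow_lt_one_of_one_lt_of_neg hp1 (by linarith)
    exact ENNReal.inv_ne_top.mpr (tsub_pos_of_lt hlt).ne'

theorem morreyHerzNorm_norm_rpow (n : ℕ) {α lam r q : ℝ} (hr : 0 < r) (hq : 0 < q) :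
    morreyHerzNorm p n α lam r q
        (fun x => ENNReal.ofReal ‖x‖ ^ (-(α + (n : ℝ) / q - lam))) =
      (∑' k : {k : ℤ // k ≤ 0}, (p : ℝ≥0∞) ^ (((k : ℤ) : ℝ) * (lam * r))) ^ (1 / r) *
        padicHaarPi p n (padicSphere p n 0) ^ (1 / q) := by
  have hpR : (0 : ℝ) < p := by exact_mod_cast (Fact.out : p.Prime).pos
  have hpE : (p : ℝ≥0∞) ≠ 0 := by exact_mod_cast (Fact.out : p.Prime).ne_zero
  have hpT : (p : ℝ≥0∞) ≠ ⊤ := ENNReal.natCast_ne_top p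
  set c := padicHaarPi p n (padicSphere p n 0)
  have hN : ∀ k : ℤ, lqNormSphere p n q k
      (fun x => ENNReal.ofReal ‖x‖ ^ (-(α + (n : ℝ) / q - lam))) =
      (p : ℝ≥0∞) ^ ((k : ℝ) * (lam - α)) * c ^ (1 / q) := by
    intro k
    have hconst : lqNormSphere p n q k
        (fun x => ENNReal.ofReal ‖x‖ ^ (-(α + (n : ℝ) / q - lam))) =
        (p : ℝ≥0∞) ^ ((k : ℝ) * (-(α + (n : ℝ) / q - lam))) *
          lqNormSphere p n q k (fun _ => 1) := by
      have hint : ∫⁻ x in padicSphere p n k,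
          (ENNReal.ofReal ‖x‖ ^ (-(α + (n : ℝ) / q - lam))) ^ q ∂padicHaarPi p n =
          ∫⁻ x in padicSphere p n k,
          ((p : ℝ≥0∞) ^ ((k : ℝ) * (-(α + (n : ℝ) / q - lam)))) ^ q * 1 ^ q ∂padicHaarPi p n := by
        refine setLIntegral_congr_fun (measurableSet_padicSphere p n k) fun x hx => ?_
        have hx' : ‖x‖ = (p : ℝ) ^ k := hx
        simp only [hx']
        rw [← Real.rpow_intCast, ← ENNReal.ofReal_rpow_of_pos hpR, ENNReal.ofReal_natCast,
          ← ENNReal.rpow_mul (p : ℝ≥0∞), ENNReal.one_rpow, mul_one]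
      rw [lqNormSphere, hint, lintegral_const_mul _ measurable_const,
        ENNReal.mul_rpow_of_nonneg _ _ (by positivity), one_div, ENNReal.rpow_rpow_inv hq.ne',
        lqNormSphere, one_div]
    rw [hconst, lqNormSphere_one p n hq, ← mul_assoc, ← ENNReal.rpow_add _ _ hpE hpT]
    congr 2
    ring
  have hconst : ∀ k₀ : ℤ, (p : ℝ≥0∞) ^ (-(k₀ : ℝ) * lam) * truncHerzNorm p n α r q k₀
      (fun x => ENNReal.ofReal ‖x‖ ^ (-(α + (n : ℝ) / q - lam))) =
      (∑' k : {k : ℤ // k ≤ 0}, (p : ℝ≥0∞) ^ (((k : ℤ) : ℝ) * (lam * r))) ^ (1 / r) *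
        c ^ (1 / q) := by
    intro k₀
    let e : {k : ℤ // k ≤ 0} ≃ {k : ℤ // k ≤ k₀} :=
      (Equiv.addRight k₀).subtypeEquiv fun a => by simp
    have hterm : ∀ k : {k : ℤ // k ≤ 0}, (p : ℝ≥0∞) ^ (((e k : ℤ) : ℝ) * α * r) *
        ((p : ℝ≥0∞) ^ (((e k : ℤ) : ℝ) * (lam - α)) * c ^ (1 / q)) ^ r =
        ((p : ℝ≥0∞) ^ ((k₀ : ℝ) * lam) * c ^ (1 / q)) ^ r *
          (p : ℝ≥0∞) ^ (((k : ℤ) : ℝ) * (lam * r)) := by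
      intro k
      have hek : ((e k : ℤ)) = k + k₀ := rfl
      rw [hek, ENNReal.mul_rpow_of_nonneg _ _ hr.le, ENNReal.mul_rpow_of_nonneg _ _ hr.le,
        ← ENNReal.rpow_mul (p : ℝ≥0∞), ← ENNReal.rpow_mul (p : ℝ≥0∞), ← mul_assoc,
        mul_right_comm _ (_ ^ r), ← ENNReal.rpow_add _ _ hpE hpT, ← ENNReal.rpow_add _ _ hpE hpT]
      congr 2
      push_cast
      ring
    rw [truncHerzNorm, ← e.tsum_eq]
    simp only [hN, hterm]
    rw [ENNReal.tsum_mul_left, ENNReal.mul_rpow_of_nonneg _ _ (by positivity : (0 : ℝ) ≤ 1 / r)]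
    simp only [one_div]
    rw [ENNReal.rpow_rpow_inv hr.ne', ← mul_assoc, ← mul_assoc, ← ENNReal.rpow_add _ _ hpE hpT,
      mul_comm]
    simp
  change ⨆ k₀ : ℤ, (p : ℝ≥0∞) ^ (-(k₀ : ℝ) * lam) * truncHerzNorm p n α r q k₀ _ = _
  simp only [hconst]
  exact iSup_const

theorem multilinearHardy_norm_rpow (n : ℕ) {m : ℕ} {ψ : (Fin m → ℚ_[p]) → ℝ≥0∞}
    (hψ : Measurable ψ) (β : ℝ) {x : Fin n → ℚ_[p]} (hx : x ≠ 0) :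
    multilinearHardy p n m ψ (fun _ y => ENNReal.ofReal ‖y‖ ^ (-β)) x =
      ENNReal.ofReal ‖x‖ ^ (-((m : ℝ) * β)) *
      ∫⁻ t in ZpstarPi p m, (∏ i, ENNReal.ofReal ‖t i‖ ^ (-β)) * ψ t ∂ padicHaarPi p m := by
  have hw : Measurable fun t : Fin m → ℚ_[p] => (∏ i, ENNReal.ofReal ‖t i‖ ^ (-β)) * ψ t :=
    (Finset.measurable_fun_prod _ fun i _ =>
      ((measurable_pi_apply i).norm.ennreal_ofReal).pow_const _).mul hψ
  rw [multilinearHardy, ← lintegral_const_mul _ hw]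
  refine lintegral_congr fun t => ?_
  have hx0 : ENNReal.ofReal ‖x‖ ≠ 0 := by simpa using hx
  have h : ∀ i, ENNReal.ofReal ‖t i • x‖ ^ (-β) =
      ENNReal.ofReal ‖t i‖ ^ (-β) * ENNReal.ofReal ‖x‖ ^ (-β) := by
    intro i
    rw [norm_smul, ENNReal.ofReal_mul (norm_nonneg _),
      ENNReal.mul_rpow_of_ne_top ENNReal.ofReal_ne_top ENNReal.ofReal_ne_top]
  simp only [h]
  rw [Finset.prod_mul_distrib, Finset.prod_const, Finset.card_univ, Fintype.card_fin,
    ← ENNReal.rpow_natCast, ← ENNReal.rpow_mul]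
  rw [show -β * (m : ℝ) = -((m : ℝ) * β) by ring]
  ring

theorem morreyHerzNorm_congr (n : ℕ) {α lam r q : ℝ} {f g : (Fin n → ℚ_[p]) → ℝ≥0∞}
    (hfg : ∀ x, x ≠ 0 → f x = g x) :
    morreyHerzNorm p n α lam r q f = morreyHerzNorm p n α lam r q g := by
  have hpR : (0 : ℝ) < p := by exact_mod_cast (Fact.out : p.Prime).pos
  have h : ∀ k, lqNormSphere p n q k f = lqNormSphere p n q k g := by
    intro k
    rw [lqNormSphere, lqNormSphere]
    congr 1
    refine setLIntegral_congr_fun (measurableSet_padicSphere p n k) fun x hx => ?_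
    have hx' : ‖x‖ = (p : ℝ) ^ k := hx
    have hx0 : x ≠ 0 := norm_pos_iff.mp (hx' ▸ zpow_pos hpR k)
    simp only [hfg x hx0]
  simp only [morreyHerzNorm, h]

theorem morreyHerzNorm_mul_const (n : ℕ) {α lam r q : ℝ} (hr : 0 < r) (hq : 0 < q)
    {f : (Fin n → ℚ_[p]) → ℝ≥0∞} (hf : Measurable f) (c : ℝ≥0∞) :
    morreyHerzNorm p n α lam r q (fun x => f x * c) = morreyHerzNorm p n α lam r q f * c := by
  change ⨆ k₀ : ℤ, (p : ℝ≥0∞) ^ (-(k₀ : ℝ) * lam) * truncHerzNorm p n α r q k₀ _ =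
    (⨆ k₀ : ℤ, (p : ℝ≥0∞) ^ (-(k₀ : ℝ) * lam) * truncHerzNorm p n α r q k₀ _) * c
  rw [ENNReal.iSup_mul]
  simp only [truncHerzNorm_mul_const p n hr hq _ _ hf, mul_assoc]

/-- Necessity part of Theorem 3.1: with `q_i = m q`, `r_i = m r`, `α_i = α/m`,
`λ_i = λ/m`, boundedness of the weighted multilinear p-adic Hardy operator on the
product of Morrey–Herz spaces forces the weight integral `C` to be finite, and the
operator norm equals `C`. -/
theorem statement5 (p n m : ℕ) [Fact p.Prime] (hn : 1 ≤ n) (hm : 1 ≤ m)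
    (α lam r q : ℝ) (hlam : 0 < lam) (hr : 1 < r) (hq : 1 < q)
    (ψ : (Fin m → ℚ_[p]) → ℝ≥0∞) (hψ : Measurable ψ)
    (hbdd : ∃ C : ℝ≥0∞, C ≠ ⊤ ∧
      ∀ f : Fin m → (Fin n → ℚ_[p]) → ℝ≥0∞, (∀ i, Measurable (f i)) →
        morreyHerzNorm p n α lam r q (multilinearHardy p n m ψ f)
          ≤ C * ∏ _i : Fin m,
              morreyHerzNorm p n (α / m) (lam / m) ((m : ℝ) * r) ((m : ℝ) * q) (f _i)) :
    (∫⁻ t in ZpstarPi p m,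
        (∏ i, ENNReal.ofReal ‖t i‖ ^ (-(α / m + (n : ℝ) / ((m : ℝ) * q) - lam / m))) * ψ t
          ∂ padicHaarPi p m) ≠ ⊤ ∧
      sInf {C : ℝ≥0∞ | ∀ f : Fin m → (Fin n → ℚ_[p]) → ℝ≥0∞, (∀ i, Measurable (f i)) →
        morreyHerzNorm p n α lam r q (multilinearHardy p n m ψ f)
          ≤ C * ∏ _i : Fin m,
              morreyHerzNorm p n (α / m) (lam / m) ((m : ℝ) * r) ((m : ℝ) * q) (f _i)}
        = ∫⁻ t in ZpstarPi p m,
            (∏ i, ENNReal.ofReal ‖t i‖ ^ (-(α / m + (n : ℝ) / ((m : ℝ) * q) - lam / m))) * ψ t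
              ∂ padicHaarPi p m := by
  have hm0 : (0 : ℝ) < m := by exact_mod_cast hm
  have hr0 : 0 < r := by linarith
  have hq0 : 0 < q := by linarith
  set β : ℝ := α / m + (n : ℝ) / ((m : ℝ) * q) - lam / m with hβ
  set A : ℝ≥0∞ := ∫⁻ t in ZpstarPi p m, (∏ i, ENNReal.ofReal ‖t i‖ ^ (-β)) * ψ t
    ∂ padicHaarPi p m
  have hpow : (m : ℝ) * β = α + n / q - lam := by rw [hβ]; field_simp
  set N : ℝ≥0∞ := morreyHerzNorm p n α lam r q
    (fun x => ENNReal.ofReal ‖x‖ ^ (-(α + (n : ℝ) / q - lam))) with hN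
  have hN_eq := morreyHerzNorm_norm_rpow p n (α := α) (lam := lam) hr0 hq0
  rw [← hN] at hN_eq
  obtain ⟨hsum0, hsumT⟩ := tsum_rpow_nonpos_ne_zero_and_ne_top p (mul_pos hlam hr0)
  have hc0 := padicHaarPi_padicSphere_zero_ne_zero p hn
  have hcT := padicHaarPi_padicSphere_zero_ne_top p n
  have hN0 : N ≠ 0 := by
    rw [hN_eq]
    exact mul_ne_zero (ENNReal.rpow_pos (pos_iff_ne_zero.mpr hsum0) hsumT).ne'
      (ENNReal.rpow_pos (pos_iff_ne_zero.mpr hc0) hcT).ne'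
  have hNT : N ≠ ⊤ := by
    rw [hN_eq]
    exact ENNReal.mul_ne_top (ENNReal.rpow_ne_top_of_nonneg (by positivity) hsumT)
      (ENNReal.rpow_ne_top_of_nonneg (by positivity) hcT)
  have hprod : ∏ _i : Fin m, morreyHerzNorm p n (α / m) (lam / m) ((m : ℝ) * r) ((m : ℝ) * q)
      (fun x => ENNReal.ofReal ‖x‖ ^ (-β)) = N := by
    rw [hβ, morreyHerzNorm_norm_rpow p n (mul_pos hm0 hr0) (mul_pos hm0 hq0), hN_eq,
      Finset.prod_const, Finset.card_univ, Fintype.card_fin, mul_pow, ← ENNReal.rpow_natCast,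
      ← ENNReal.rpow_natCast, ← ENNReal.rpow_mul, ← ENNReal.rpow_mul]
    have e1 : lam / m * (m * r) = lam * r := by field_simp
    have e2 : 1 / ((m : ℝ) * r) * m = 1 / r := by field_simp
    have e3 : 1 / ((m : ℝ) * q) * m = 1 / q := by field_simp
    rw [e1, e2, e3]
  have hhardy : morreyHerzNorm p n α lam r q
      (multilinearHardy p n m ψ fun _ x => ENNReal.ofReal ‖x‖ ^ (-β)) = N * A := by
    rw [morreyHerzNorm_congr p n fun x hx => multilinearHardy_norm_rpow p n hψ β hx, hpow,
      morreyHerzNorm_mul_const p n hr0 hq0 (measurable_norm.ennreal_ofReal.pow_const _)]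
  have hlower : ∀ C : ℝ≥0∞, (∀ f : Fin m → (Fin n → ℚ_[p]) → ℝ≥0∞, (∀ i, Measurable (f i)) →
      morreyHerzNorm p n α lam r q (multilinearHardy p n m ψ f) ≤ C * ∏ _i : Fin m,
        morreyHerzNorm p n (α / m) (lam / m) ((m : ℝ) * r) ((m : ℝ) * q) (f _i)) → A ≤ C := by
    intro C hC
    have h := hC (fun _ x => ENNReal.ofReal ‖x‖ ^ (-β))
      fun _ => measurable_norm.ennreal_ofReal.pow_const _
    rw [hhardy, hprod, mul_comm] at h
    exact (ENNReal.mul_le_mul_iff_left hN0 hNT).mp h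
  obtain ⟨C, hCT, hC⟩ := hbdd
  refine ⟨ne_top_of_le_ne_top hCT (hlower C hC), le_antisymm (sInf_le fun f hf => ?_)
    (le_sInf hlower)⟩
  exact morreyHerzNorm_multilinearHardy_le p n hm hr hq hψ hf

end
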